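/- arXiv:1001.3191 — 2 statements merged into one kernel-verified Lean document; each statement's English description precedes it below -/
import Mathlib

section
/- Let c > 0, w₀ ≥ 0, let f : ℝ → ℝ be continuous with f(s) ≥ c·s for all s ≥ 0, and let x : [0,∞) → ℝ be continuous with x(t) ≥ 0 for all t ≥ 0 and satisfying the integral equation x(t) = w₀·t − ∫₀^t f(x(τ)) dτ for all t ≥ 0. Then x(t) ≤ w₀/c for all t ≥ 0, and hence limsup_{t→∞} x(t) ≤ w₀/c < +∞. -/
open Real Filter

/-- If `f` is continuous with `f(s) ≥ c·s` for `s ≥ 0` and `x` is continuous, nonnegative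
on `[0,∞)`, and satisfies `x(t) = w₀·t − ∫₀^t f(x(τ)) dτ`, then `x(t) ≤ w₀/c` for all
`t ≥ 0`, and hence `limsup_{t→∞} x(t) ≤ w₀/c`. -/
theorem interface_integral_equation_bound (c w₀ : ℝ) (hc : 0 < c) (hw : 0 ≤ w₀)
    (f : ℝ → ℝ) (hf : Continuous f) (hfc : ∀ s ≥ (0:ℝ), f s ≥ c * s)
    (x : ℝ → ℝ) (hx : ContinuousOn x (Set.Ici 0))
    (hxn : ∀ t ≥ (0:ℝ), 0 ≤ x t)
    (heq : ∀ t ≥ (0:ℝ), x t = w₀ * t - ∫ τ in (0:ℝ)..t, f (x τ)) :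
    (∀ t ≥ (0:ℝ), x t ≤ w₀ / c) ∧ Filter.limsup x Filter.atTop ≤ w₀ / c := by
  have hg : Continuous fun τ => f (x (max τ 0)) :=
    hf.comp (hx.comp_continuous (by fun_prop) fun τ => le_max_right τ 0)
  have hxeq : ∀ t ≥ (0:ℝ), x t = w₀ * t - ∫ τ in (0:ℝ)..t, f (x (max τ 0)) := by
    intro t ht
    rw [heq t ht]
    congr 1
    refine intervalIntegral.integral_congr fun τ hτ => ?_
    rw [Set.uIcc_of_le ht] at hτ
    simp only [max_eq_left hτ.1]
  have hderiv : ∀ t ≥ (0:ℝ), HasDerivWithinAt x (w₀ - f (x t)) (Set.Ici t) t := by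
    intro t ht
    have h : HasDerivAt (fun s => w₀ * s - ∫ τ in (0:ℝ)..s, f (x (max τ 0)))
        (w₀ - f (x t)) t := by
      have h₁ := (hasDerivAt_id t).const_mul w₀
      have h₂ := hg.integral_hasStrictDerivAt 0 t
      simpa [max_eq_left ht] using h₁.fun_sub h₂.hasDerivAt
    exact h.hasDerivWithinAt.congr (fun s hs => hxeq s (ht.le.trans hs)) (hxeq t ht)
  have hbound : ∀ t ≥ (0:ℝ), x t ≤ w₀ / c := by
    intro t ht
    refine le_of_forall_pos_le_add fun ε hε => ?_
    refine image_le_of_deriv_right_lt_deriv_boundary (a := 0) (b := t)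
      (f' := fun s => w₀ - f (x s)) (B := fun _ => w₀ / c + ε) (B' := fun _ => 0)
      (hx.mono Set.Icc_subset_Ici_self) (fun s hs => hderiv s hs.1) ?_
      (fun s => hasDerivAt_const s _) ?_ ⟨ht, le_rfl⟩
    · rw [heq 0 le_rfl]
      simp only [mul_zero, intervalIntegral.integral_same, sub_zero]
      positivity
    · intro s hs h
      have hfs := hfc (x s) (hxn s hs.1)
      have hcx : c * x s = w₀ + c * ε := by
        rw [h]
        field_simp
      have := mul_pos hc hε
      linarith
  refine ⟨hbound, limsup_le_of_le ?_ ?_⟩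
  · refine IsBoundedUnder.isCoboundedUnder_le ⟨0, ?_⟩
    exact eventually_map.2 ((eventually_ge_atTop 0).mono hxn)
  · exact (eventually_ge_atTop 0).mono hbound
end

section
/- Let π_S > 0, λ > 0, 0 < Θ_S < Θ_E, and 0 < p_S be constants with Q := π_S·exp(λ·(1/Θ_S − 1/Θ_E)) < p_S, and set c := 1 − Q/p_S, so c ∈ (0,1). Let w₀ ≥ 0, let δ : ℝ → ℝ be continuous with δ(s) ≥ c for all s ≥ 0, and let x : [0,∞) → ℝ be continuous with x(t) ≥ 0 for all t ≥ 0 and x(t) = w₀·t − ∫₀^t (∫₀^{x(τ)} δ(s) ds) dτ for all t ≥ 0. Then limsup_{t→∞} x(t) ≤ w₀/(1 − Q/p_S) < +∞; in particular the interface position remains bounded for all time. -/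
open Real Filter

/-- A solution of the integrated equation `x' = w - ∫₀ˣ δ` with `δ ≥ c > 0` on the
half-line stays below the equilibrium level `w / c`. -/
theorem le_div_of_eq_sub_integral {w c : ℝ} (hw : 0 ≤ w) (hc : 0 < c) {δ : ℝ → ℝ}
    (hδcont : Continuous δ) (hδ : ∀ s ≥ (0 : ℝ), c ≤ δ s) {x : ℝ → ℝ}
    (hx : ContinuousOn x (Set.Ici 0))
    (heq : ∀ t ≥ (0 : ℝ), x t = w * t - ∫ τ in (0 : ℝ)..t, ∫ s in (0 : ℝ)..(x τ), δ s)
    {t : ℝ} (ht : 0 ≤ t) : x t ≤ w / c := by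
  have lower : ∀ y ≥ (0 : ℝ), c * y ≤ ∫ s in (0 : ℝ)..y, δ s := by
    intro y hy
    have h := intervalIntegral.integral_mono_on (μ := MeasureTheory.volume) (f := fun _ => c) hy
      intervalIntegrable_const (hδcont.intervalIntegrable 0 y) fun s hs => hδ s hs.1
    simpa [mul_comm] using h
  have hprim : Continuous fun y => ∫ s in (0 : ℝ)..y, δ s :=
    intervalIntegral.continuous_primitive (fun a b => hδcont.intervalIntegrable a b) 0
  have hrate : Continuous fun τ => ∫ s in (0 : ℝ)..(x (max τ 0)), δ s :=
    hprim.comp (hx.comp_continuous (by fun_prop) fun τ => le_max_right τ 0)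
  have hderiv : ∀ u, HasDerivAt
      (fun u => w * u - ∫ τ in (0 : ℝ)..u, ∫ s in (0 : ℝ)..(x (max τ 0)), δ s)
      (w - ∫ s in (0 : ℝ)..(x (max u 0)), δ s) u := fun u => by
    exact (hasDerivAt_const_mul w).fun_sub (hrate.integral_hasStrictDerivAt 0 u).hasDerivAt
  have hext : ∀ u ≥ (0 : ℝ),
      x u = w * u - ∫ τ in (0 : ℝ)..u, ∫ s in (0 : ℝ)..(x (max τ 0)), δ s := by
    intro u hu
    rw [heq u hu]
    congr 1
    refine intervalIntegral.integral_congr fun τ hτ => ?_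
    rw [Set.uIcc_of_le hu] at hτ
    simp only [max_eq_left hτ.1]
  have hwc : 0 ≤ w / c := div_nonneg hw hc.le
  refine le_of_forall_pos_le_add fun ε hε => ?_
  rw [hext t ht]
  refine image_le_of_deriv_right_lt_deriv_boundary (a := 0) (b := t)
    (B := fun _ => w / c + ε) (B' := fun _ => 0)
    (fun u _ => (hderiv u).continuousAt.continuousWithinAt)
    (fun u _ => (hderiv u).hasDerivWithinAt) (by simp; positivity)
    (fun u => hasDerivAt_const u _) ?_ ⟨ht, le_rfl⟩
  intro u hu huB
  rw [← hext u hu.1] at huB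
  rw [max_eq_left hu.1, huB]
  have h := lower (w / c + ε) (by positivity)
  rw [mul_add, mul_div_cancel₀ _ hc.ne'] at h
  linarith [mul_pos hc hε]

/-- Main result: with `Q = π_S·exp(λ·(1/Θ_S − 1/Θ_E)) < p_S` the asymptotic saturated-vapor
pressure and `c = 1 − Q/p_S ∈ (0,1)`, if the condensation function `δ` satisfies
`δ(s) ≥ c` for `s ≥ 0` and the interface position `x ≥ 0` satisfies
`x(t) = w₀·t − ∫₀^t (∫₀^{x(τ)} δ(s) ds) dτ`, then
`limsup_{t→∞} x(t) ≤ w₀/(1 − Q/p_S)`; in particular the interface position remains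
bounded for all time. -/
theorem interface_position_bounded (πS lam ΘS ΘE pS : ℝ)
    (hπS : 0 < πS) (hlam : 0 < lam) (hΘS : 0 < ΘS) (hΘ : ΘS < ΘE) (hpS : 0 < pS)
    (hQ : πS * Real.exp (lam * (1 / ΘS - 1 / ΘE)) < pS)
    (w₀ : ℝ) (hw : 0 ≤ w₀)
    (δ : ℝ → ℝ) (hδcont : Continuous δ)
    (hδ : ∀ s ≥ (0:ℝ), δ s ≥ 1 - πS * Real.exp (lam * (1 / ΘS - 1 / ΘE)) / pS)
    (x : ℝ → ℝ) (hx : ContinuousOn x (Set.Ici 0))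
    (hxn : ∀ t ≥ (0:ℝ), 0 ≤ x t)
    (heq : ∀ t ≥ (0:ℝ), x t = w₀ * t - ∫ τ in (0:ℝ)..t, ∫ s in (0:ℝ)..(x τ), δ s) :
    (1 - πS * Real.exp (lam * (1 / ΘS - 1 / ΘE)) / pS) ∈ Set.Ioo (0:ℝ) 1 ∧
    Filter.limsup x Filter.atTop
      ≤ w₀ / (1 - πS * Real.exp (lam * (1 / ΘS - 1 / ΘE)) / pS) ∧
    ∃ M : ℝ, ∀ t ≥ (0:ℝ), x t ≤ M := by
  have hc : 0 < 1 - πS * Real.exp (lam * (1 / ΘS - 1 / ΘE)) / pS :=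
    sub_pos.2 ((div_lt_one hpS).2 hQ)
  have hbound := fun t (ht : t ≥ (0 : ℝ)) => le_div_of_eq_sub_integral hw hc hδcont hδ hx heq ht
  refine ⟨⟨hc, sub_lt_self _ (by positivity)⟩, ?_, _, hbound⟩
  refine limsup_le_of_le ?_ ((eventually_ge_atTop 0).mono hbound)
  exact IsCoboundedUnder.of_frequently_ge ((eventually_ge_atTop 0).mono hxn).frequently
end
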